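/- arXiv:2403.19080 — 5 statements merged into one kernel-verified Lean document; each statement's English description precedes it below -/
import Mathlib

section
/- Let (Υ, ν) be a measure space and let f, g : Υ → [0,∞) be measurable functions with ∫ f dν = ∫ g dν = 1 (the densities of random variables X and Y). Let h : Υ → [0,1] be measurable (h(E) is the probability that a possibly randomized test Z outputs 1 on input E). For a real μ > 0, set W₁ = {E ∈ Υ : g(E) < μ·f(E)} and W₂ = {E ∈ Υ : g(E) = μ·f(E)}, and let S = W₁ ∪ W₃ where W₃ is any measurable subset of W₂. If ∫ h·f dν ≥ ∫_S f dν, then ∫ h·g dν ≥ ∫_S g dν. -/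
open MeasureTheory
open scoped ENNReal

/-- The pointwise inequality behind the Neyman–Pearson lemma, in a form free of subtraction. -/
theorem indicator_add_mul_le_mul_add_indicator {α : Type*} {S : Set α} {f g h : α → ℝ≥0∞}
    {c : ℝ≥0∞} {x : α} (hx : h x ≤ 1) (hmem : x ∈ S → g x ≤ c * f x)
    (hnot : x ∉ S → c * f x ≤ g x) :
    S.indicator g x + c * (h x * f x) ≤ h x * g x + c * S.indicator f x := by
  by_cases hS : x ∈ S
  · obtain ⟨k, hk⟩ := exists_add_of_le hx
    simp only [Set.indicator_of_mem hS]
    calc g x + c * (h x * f x) = (h x + k) * g x + c * (h x * f x) := by rw [← hk, one_mul]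
      _ = h x * g x + c * (h x * f x) + k * g x := by ring
      _ ≤ h x * g x + c * (h x * f x) + k * (c * f x) := by gcongr; exact hmem hS
      _ = h x * g x + c * ((h x + k) * f x) := by ring
      _ = h x * g x + c * f x := by rw [← hk, one_mul]
  · simp only [Set.indicator_of_notMem hS, zero_add, mul_zero, add_zero]
    calc c * (h x * f x) = h x * (c * f x) := by ring
      _ ≤ h x * g x := by gcongr; exact hnot hS

/-- Neyman–Pearson Lemma, part (1), as used in the paper (Lemma 1(1)):
`f` and `g` are the densities of `X` and `Y` w.r.t. `ν`, `h E` is the probability that the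
(possibly randomized) test `Z` outputs `1` on `E`, so `∫ h·f dν = Pr(Z(X)=1)`,
`∫ h·g dν = Pr(Z(Y)=1)`, `∫_S f dν = Pr(X ∈ S)` and `∫_S g dν = Pr(Y ∈ S)`. -/
theorem neyman_pearson_part1 {Υ : Type*} [MeasurableSpace Υ] (ν : Measure Υ)
    (f g : Υ → ℝ≥0∞) (hf : Measurable f) (hg : Measurable g)
    (hf1 : ∫⁻ E, f E ∂ν = 1) (hg1 : ∫⁻ E, g E ∂ν = 1)
    (h : Υ → ℝ≥0∞) (hh : Measurable h) (hh1 : ∀ E, h E ≤ 1)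
    (μ : ℝ) (hμ : 0 < μ)
    (W₃ : Set Υ) (hW₃meas : MeasurableSet W₃)
    (hW₃ : W₃ ⊆ {E | g E = ENNReal.ofReal μ * f E})
    (S : Set Υ) (hS : S = {E | g E < ENNReal.ofReal μ * f E} ∪ W₃)
    (hyp : ∫⁻ E, h E * f E ∂ν ≥ ∫⁻ E in S, f E ∂ν) :
    ∫⁻ E, h E * g E ∂ν ≥ ∫⁻ E in S, g E ∂ν := by
  have hSmeas : MeasurableSet S := by
    rw [hS]
    exact (measurableSet_lt hg (hf.const_mul _)).union hW₃meas
  have hmem : ∀ E ∈ S, g E ≤ ENNReal.ofReal μ * f E := by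
    intro E hE
    rw [hS] at hE
    exact hE.elim (fun hlt => le_of_lt hlt) (fun hE₃ => (hW₃ hE₃).le)
  have hnot : ∀ E ∉ S, ENNReal.ofReal μ * f E ≤ g E := by
    intro E hE
    rw [hS] at hE
    exact not_lt.mp fun hlt => hE (Or.inl hlt)
  have hfin : ENNReal.ofReal μ * ∫⁻ E, h E * f E ∂ν ≠ ∞ := by
    refine ENNReal.mul_ne_top ENNReal.ofReal_ne_top (ne_top_of_le_ne_top ENNReal.one_ne_top ?_)
    rw [← hf1]
    exact lintegral_mono fun E => mul_le_of_le_one_left' (hh1 E)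
  refine (ENNReal.add_le_add_iff_right hfin).mp ?_
  calc ∫⁻ E in S, g E ∂ν + ENNReal.ofReal μ * ∫⁻ E, h E * f E ∂ν
      = ∫⁻ E, (S.indicator g E + ENNReal.ofReal μ * (h E * f E)) ∂ν := by
        rw [lintegral_add_left (hg.indicator hSmeas), lintegral_indicator hSmeas,
          lintegral_const_mul' _ _ ENNReal.ofReal_ne_top]
    _ ≤ ∫⁻ E, (h E * g E + ENNReal.ofReal μ * S.indicator f E) ∂ν :=
        lintegral_mono fun E =>
          indicator_add_mul_le_mul_add_indicator (hh1 E) (hmem E) (hnot E)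
    _ = ∫⁻ E, h E * g E ∂ν + ENNReal.ofReal μ * ∫⁻ E in S, f E ∂ν := by
        rw [lintegral_add_left (by fun_prop), lintegral_const_mul' _ _ ENNReal.ofReal_ne_top,
          lintegral_indicator hSmeas]
    _ ≤ ∫⁻ E, h E * g E ∂ν + ENNReal.ofReal μ * ∫⁻ E, h E * f E ∂ν := by gcongr
end

section
/- Let (Υ, ν) be a measure space and let f, g : Υ → [0,∞) be measurable functions with ∫ f dν = ∫ g dν = 1 (the densities of random variables X and Y). Let h : Υ → [0,1] be measurable (h(E) is the probability that a possibly randomized test Z outputs 1 on input E). For a real μ > 0, set W₁ = {E ∈ Υ : g(E) > μ·f(E)} and W₂ = {E ∈ Υ : g(E) = μ·f(E)}, and let S = W₁ ∪ W₃ where W₃ is any measurable subset of W₂. If ∫ h·f dν ≤ ∫_S f dν, then ∫ h·g dν ≤ ∫_S g dν. -/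
open MeasureTheory
open scoped ENNReal

/-- Neyman–Pearson Lemma, part (2), as used in the paper (Lemma 1(2)):
`f` and `g` are the densities of `X` and `Y` w.r.t. `ν`, `h E` is the probability that the
(possibly randomized) test `Z` outputs `1` on `E`, so `∫ h·f dν = Pr(Z(X)=1)`,
`∫ h·g dν = Pr(Z(Y)=1)`, `∫_S f dν = Pr(X ∈ S)` and `∫_S g dν = Pr(Y ∈ S)`. -/
theorem neyman_pearson_part2 {Υ : Type*} [MeasurableSpace Υ] (ν : Measure Υ)
    (f g : Υ → ℝ≥0∞) (hf : Measurable f) (hg : Measurable g)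
    (hf1 : ∫⁻ E, f E ∂ν = 1) (hg1 : ∫⁻ E, g E ∂ν = 1)
    (h : Υ → ℝ≥0∞) (hh : Measurable h) (hh1 : ∀ E, h E ≤ 1)
    (μ : ℝ) (hμ : 0 < μ)
    (W₃ : Set Υ) (hW₃meas : MeasurableSet W₃)
    (hW₃ : W₃ ⊆ {E | g E = ENNReal.ofReal μ * f E})
    (S : Set Υ) (hS : S = {E | g E > ENNReal.ofReal μ * f E} ∪ W₃)
    (hyp : ∫⁻ E, h E * f E ∂ν ≤ ∫⁻ E in S, f E ∂ν) :
    ∫⁻ E, h E * g E ∂ν ≤ ∫⁻ E in S, g E ∂ν := by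
  set m := ENNReal.ofReal μ
  have hS_meas : MeasurableSet S := by
    rw [hS]
    exact (measurableSet_lt (hf.const_mul m) hg).union hW₃meas
  have h_mem : ∀ E ∈ S, m * f E ≤ g E := by
    rw [hS]
    rintro E (hE | hE)
    · exact le_of_lt hE
    · exact (hW₃ hE).ge
  have h_notMem : ∀ E ∉ S, g E ≤ m * f E := by
    rw [hS]
    intro E hE
    exact not_lt.mp fun hlt => hE (Or.inl hlt)
  have pointwise : ∀ E, h E * g E + m * S.indicator f E ≤
      S.indicator g E + m * (h E * f E) := by
    intro E
    by_cases hE : E ∈ S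
    · obtain ⟨d, hd⟩ := exists_add_of_le (h_mem E hE)
      rw [Set.indicator_of_mem hE, Set.indicator_of_mem hE, hd]
      calc h E * (m * f E + d) + m * f E = m * f E + h E * d + m * (h E * f E) := by ring
        _ ≤ m * f E + d + m * (h E * f E) := by
          gcongr
          exact mul_le_of_le_one_left' (hh1 E)
    · rw [Set.indicator_of_notMem hE, Set.indicator_of_notMem hE, mul_zero, add_zero, zero_add,
        mul_left_comm]
      gcongr
      exact h_notMem E hE
  have integrated : ∫⁻ E, h E * g E ∂ν + m * ∫⁻ E in S, f E ∂ν ≤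
      ∫⁻ E in S, g E ∂ν + m * ∫⁻ E, h E * f E ∂ν := by
    have key := lintegral_mono (μ := ν) pointwise
    rwa [lintegral_add_left (by fun_prop), lintegral_add_left (hg.indicator hS_meas),
      lintegral_const_mul _ (hf.indicator hS_meas), lintegral_const_mul _ (by fun_prop),
      lintegral_indicator hS_meas, lintegral_indicator hS_meas] at key
  have h_ne_top : m * ∫⁻ E in S, f E ∂ν ≠ ∞ := by
    refine ENNReal.mul_ne_top ENNReal.ofReal_ne_top (ne_top_of_le_ne_top ENNReal.one_ne_top ?_)
    exact hf1 ▸ setLIntegral_le_lintegral S f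
  refine (ENNReal.add_le_add_iff_right h_ne_top).mp (integrated.trans ?_)
  gcongr
end

section
/- Let α be a type and Ω_X, Ω_Y nonempty finite subsets of α with N_X = |Ω_X|, N_Y = |Ω_Y|, and E = |Ω_X ∩ Ω_Y|. Let X be uniformly distributed on Ω_X and Y uniformly distributed on Ω_Y. Let g : α → L be an arbitrary function into a label type L, let A ∈ L, and let p ∈ [0,1] be a real number with Pr(g(X) = A) ≥ p. Define δ_l = p − ⌊p·N_X⌋/N_X. Then Pr(g(Y) = A) ≥ (N_X / N_Y) · (p − δ_l − 1 + E/N_X). -/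
/-- The probability of an event `P` under the uniform distribution on a finite set `Ω`:
`Pr(P) = |{x ∈ Ω : P x}| / |Ω|`. -/
noncomputable def uniformProb {β : Type*} (Ω : Finset β) (P : β → Prop) [DecidablePred P] : ℝ :=
  ((Ω.filter P).card : ℝ) / (Ω.card : ℝ)

/-- Inclusion-exclusion bound: an event on `s` restricted to `s ∩ t` is an event on `t`. -/
theorem card_filter_add_card_inter_le {α : Type*} [DecidableEq α] (s t : Finset α)
    (P : α → Prop) [DecidablePred P] :
    (s.filter P).card + (s ∩ t).card ≤ s.card + (t.filter P).card := by
  rw [← Finset.card_union_add_card_inter]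
  refine add_le_add (Finset.card_le_card ?_) (Finset.card_le_card ?_)
  · exact Finset.union_subset (Finset.filter_subset _ _) Finset.inter_subset_left
  · intro x hx
    simp only [Finset.mem_inter, Finset.mem_filter] at hx ⊢
    exact ⟨hx.2.2, hx.1.2⟩

/-- Lower-bound step of the paper's Theorem 1: for `X` uniform on `Ω_X` and `Y` uniform on
`Ω_Y`, with `N_X = |Ω_X|`, `N_Y = |Ω_Y|`, `E = |Ω_X ∩ Ω_Y|`, a classifier `g`, a label `A`,
and `p ∈ [0,1]` with `Pr(g(X) = A) ≥ p`, setting `δ_l = p − ⌊p·N_X⌋/N_X`, one has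
`Pr(g(Y) = A) ≥ (N_X/N_Y)·(p − δ_l − 1 + E/N_X)`. -/
theorem uniform_label_prob_lower_bound {α L : Type*} [DecidableEq α] [DecidableEq L]
    (ΩX ΩY : Finset α) (hX : ΩX.Nonempty) (hY : ΩY.Nonempty)
    (NX NY E : ℕ) (hNX : ΩX.card = NX) (hNY : ΩY.card = NY) (hE : (ΩX ∩ ΩY).card = E)
    (g : α → L) (A : L) (p : ℝ) (hp0 : 0 ≤ p) (hp1 : p ≤ 1)
    (hpA : uniformProb ΩX (fun x => g x = A) ≥ p)
    (δl : ℝ) (hδl : δl = p - (⌊p * (NX : ℝ)⌋ : ℝ) / (NX : ℝ)) :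
    uniformProb ΩY (fun x => g x = A)
      ≥ ((NX : ℝ) / (NY : ℝ)) * (p - δl - 1 + (E : ℝ) / (NX : ℝ)) := by
  have hX0 : (0 : ℝ) < NX := by exact_mod_cast hNX ▸ hX.card_pos
  have hY0 : (0 : ℝ) < NY := by exact_mod_cast hNY ▸ hY.card_pos
  have hcard := card_filter_add_card_inter_le ΩX ΩY (fun x => g x = A)
  rw [hE, hNX] at hcard
  have hcard' : ((ΩX.filter (fun x => g x = A)).card : ℝ) + E
      ≤ NX + (ΩY.filter (fun x => g x = A)).card := by exact_mod_cast hcard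
  unfold uniformProb at hpA ⊢
  rw [hNX, ge_iff_le, le_div_iff₀ hX0] at hpA
  have hfloor := Int.floor_le (p * (NX : ℝ))
  have hrhs : ((NX : ℝ) / NY) * (p - δl - 1 + (E : ℝ) / NX)
      = ((⌊p * (NX : ℝ)⌋ : ℝ) - NX + E) / NY := by
    rw [hδl]
    field_simp
    ring
  rw [hrhs, hNY, ge_iff_le, div_le_div_iff_of_pos_right hY0]
  linarith
end

section
/- Let α be a type and Ω_X, Ω_Y nonempty finite subsets of α with N_X = |Ω_X|, N_Y = |Ω_Y|, and E = |Ω_X ∩ Ω_Y|. Let X be uniformly distributed on Ω_X and Y uniformly distributed on Ω_Y. Let g : α → L be an arbitrary function into a label type L and A ∈ L. Suppose p, q ∈ [0,1] are reals such that Pr(g(X) = A) ≥ p and Pr(g(X) = l) ≤ q for every label l ≠ A. Define δ_l = p − ⌊p·N_X⌋/N_X and δ_u = ⌈q·N_X⌉/N_X − q. If (N_X/N_Y)·(p − δ_l − 1 + E/N_X) ≥ (N_X/N_Y)·(q + δ_u) + 1 − E/N_Y, then Pr(g(Y) = A) ≥ Pr(g(Y) = l) for every label l ≠ A. -/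
/-- Passing from `S` to `T` loses at most the `|S \ T|` elements of `S` outside `T`. -/
theorem card_filter_add_card_inter_le_s7 {β : Type*} [DecidableEq β] (S T : Finset β)
    (P : β → Prop) [DecidablePred P] :
    (S.filter P).card + (S ∩ T).card ≤ (T.filter P).card + S.card := by
  have hsub : S.filter P ⊆ T.filter P ∪ S \ T := by
    intro x hx
    simp only [Finset.mem_filter, Finset.mem_union, Finset.mem_sdiff] at hx ⊢
    tauto
  have hcard := (Finset.card_le_card hsub).trans (Finset.card_union_le _ _)
  have hsplit := Finset.card_sdiff_add_card_inter S T
  omega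

/-- Abstract form of the paper's Theorem 1: for `X` uniform on `Ω_X` and `Y` uniform on
`Ω_Y`, with `N_X = |Ω_X|`, `N_Y = |Ω_Y|`, `E = |Ω_X ∩ Ω_Y|`, a classifier `g`, a label `A`,
and `p, q ∈ [0,1]` with `Pr(g(X) = A) ≥ p` and `Pr(g(X) = l) ≤ q` for every `l ≠ A`,
setting `δ_l = p − ⌊p·N_X⌋/N_X` and `δ_u = ⌈q·N_X⌉/N_X − q`: if
`(N_X/N_Y)·(p − δ_l − 1 + E/N_X) ≥ (N_X/N_Y)·(q + δ_u) + 1 − E/N_Y`, then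
`Pr(g(Y) = A) ≥ Pr(g(Y) = l)` for every label `l ≠ A`. -/
theorem uniform_certification {α L : Type*} [DecidableEq α] [DecidableEq L]
    (ΩX ΩY : Finset α) (hX : ΩX.Nonempty) (hY : ΩY.Nonempty)
    (NX NY E : ℕ) (hNX : ΩX.card = NX) (hNY : ΩY.card = NY) (hE : (ΩX ∩ ΩY).card = E)
    (g : α → L) (A : L) (p q : ℝ) (hp0 : 0 ≤ p) (hp1 : p ≤ 1) (hq0 : 0 ≤ q) (hq1 : q ≤ 1)
    (hpA : uniformProb ΩX (fun x => g x = A) ≥ p)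
    (hqB : ∀ l : L, l ≠ A → uniformProb ΩX (fun x => g x = l) ≤ q)
    (δl δu : ℝ)
    (hδl : δl = p - (⌊p * (NX : ℝ)⌋ : ℝ) / (NX : ℝ))
    (hδu : δu = (⌈q * (NX : ℝ)⌉ : ℝ) / (NX : ℝ) - q)
    (hcond : ((NX : ℝ) / (NY : ℝ)) * (p - δl - 1 + (E : ℝ) / (NX : ℝ))
      ≥ ((NX : ℝ) / (NY : ℝ)) * (q + δu) + 1 - (E : ℝ) / (NY : ℝ)) :
    ∀ l : L, l ≠ A →
      uniformProb ΩY (fun x => g x = A) ≥ uniformProb ΩY (fun x => g x = l) := by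
  intro l hl
  have hB := hqB l hl
  subst hNX hNY hE hδl hδu
  have hX0 : (0 : ℝ) < ΩX.card := by exact_mod_cast hX.card_pos
  have hY0 : (0 : ℝ) < ΩY.card := by exact_mod_cast hY.card_pos
  unfold uniformProb at *
  rw [ge_iff_le, le_div_iff₀ hX0] at hpA
  rw [div_le_iff₀ hX0] at hB
  have hcount : (⌈q * (ΩX.card : ℝ)⌉ : ℝ) + ΩY.card - (ΩX ∩ ΩY).card
      ≤ ⌊p * (ΩX.card : ℝ)⌋ - ΩX.card + (ΩX ∩ ΩY).card := by
    have h := mul_le_mul_of_nonneg_right hcond hY0.le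
    field_simp at h
    rw [mul_comm (ΩX.card : ℝ) p, mul_comm (ΩX.card : ℝ) q] at h
    linarith
  have hA : ((ΩX.filter (fun x => g x = A)).card : ℝ) + (ΩX ∩ ΩY).card
      ≤ (ΩY.filter (fun x => g x = A)).card + ΩX.card := by
    exact_mod_cast card_filter_add_card_inter_le_s7 ΩX ΩY _
  have hL : ((ΩY.filter (fun x => g x = l)).card : ℝ) + (ΩX ∩ ΩY).card
      ≤ (ΩX.filter (fun x => g x = l)).card + ΩY.card := by
    rw [Finset.inter_comm]
    exact_mod_cast card_filter_add_card_inter_le_s7 ΩY ΩX _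
  have hfloor := Int.floor_le (p * (ΩX.card : ℝ))
  have hceil := Int.le_ceil (q * (ΩX.card : ℝ))
  apply div_le_div_of_nonneg_right _ hY0.le
  linarith
end

section
/- (Theorem 1, modification attack.) Fix T ∈ ℕ. For i = 1,…,T, let m_i be a finite set with n_i = |m_i|, let r_i ∈ ℕ with r_i ≤ n_i, and let k_i be a sub-sampling size with k_i ≤ n_i − r_i. Let Ω_X be the set of tuples (z_1,…,z_T) where each z_i is a k_i-element subset of m_i, and let X be uniformly distributed on Ω_X. Let g be an arbitrary function from tuples to a label type, A a label, and p_A, p_B ∈ [0,1] reals with Pr(g(X) = A) ≥ p_A and Pr(g(X) = l) ≤ p_B for every label l ≠ A. Define δ_l = p_A − ⌊p_A·∏_{i=1}^T C(n_i,k_i)⌋/∏_{i=1}^T C(n_i,k_i) and δ_u = ⌈p_B·∏_{i=1}^T C(n_i,k_i)⌉/∏_{i=1}^T C(n_i,k_i) − p_B, and set e_i = n_i − r_i. Suppose (p_A − δ_l − 1 + ∏_{i=1}^T C(e_i,k_i)/∏_{i=1}^T C(n_i,k_i)) ≥ (p_B + δ_u) + 1 − ∏_{i=1}^T C(e_i,k_i)/∏_{i=1}^T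 C(n_i,k_i). Then for every choice of finite sets m'_1,…,m'_T with |m'_i| = n_i and |m_i ∩ m'_i| ≥ n_i − r_i for all i, letting Y be uniformly distributed on the set Ω_Y of tuples (z_1,…,z_T) with each z_i a k_i-element subset of m'_i, we have Pr(g(Y) = A) ≥ Pr(g(Y) = l) for every label l ≠ A. -/
open Finset in
theorem card_filter_le_card_filter_add_card_sdiff {β : Type*} [DecidableEq β] (s t : Finset β)
    (P : β → Prop) [DecidablePred P] :
    (s.filter P).card ≤ (t.filter P).card + (s \ t).card := by
  refine (card_le_card fun x hx => ?_).trans (card_union_le _ _)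
  simp only [mem_filter, mem_union, mem_sdiff] at hx ⊢
  tauto

theorem card_piFinset_powersetCard {ι : Type*} [Fintype ι] [DecidableEq ι] {α : ι → Type*}
    (m : ∀ i, Finset (α i)) (k : ι → ℕ) :
    (Fintype.piFinset fun i => (m i).powersetCard (k i)).card =
      ∏ i, ((m i).card).choose (k i) := by
  simp [Fintype.card_piFinset]

theorem prod_choose_le_card_inter_piFinset_powersetCard {ι : Type*} [Fintype ι] [DecidableEq ι]
    {α : ι → Type*} [∀ i, DecidableEq (α i)] (m m' : ∀ i, Finset (α i)) (e k : ι → ℕ)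
    (h : ∀ i, e i ≤ (m i ∩ m' i).card) :
    ∏ i, (e i).choose (k i) ≤
      ((Fintype.piFinset fun i => (m i).powersetCard (k i)) ∩
        Fintype.piFinset fun i => (m' i).powersetCard (k i)).card := by
  calc ∏ i, (e i).choose (k i) ≤ ∏ i, ((m i ∩ m' i).card).choose (k i) :=
        Finset.prod_le_prod' fun i _ => Nat.choose_le_choose (k i) (h i)
    _ = (Fintype.piFinset fun i => (m i ∩ m' i).powersetCard (k i)).card :=
        (card_piFinset_powersetCard _ k).symm
    _ ≤ _ := Finset.card_le_card fun z hz => by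
        simp only [Finset.mem_inter, Fintype.mem_piFinset, Finset.mem_powersetCard,
          Finset.subset_inter_iff] at hz ⊢
        exact ⟨fun i => ⟨(hz i).1.1, (hz i).2⟩, fun i => ⟨(hz i).1.2, (hz i).2⟩⟩

/-- The paper's Theorem 1 for modification attacks: a modification attack of size
`(r 1, …, r T)` replaces at most `r i` basic elements of modality `m i`, so the perturbed
modality `m' i` satisfies `|m' i| = n i` and `|m i ∩ m' i| ≥ n i − r i`.  With `e i = n i − r i`,
if `Pr(g(X) = A) ≥ p_A`, `Pr(g(X) = l) ≤ p_B` for all `l ≠ A`, and the certification condition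
holds, then for every such perturbation, `Pr(g(Y) = A) ≥ Pr(g(Y) = l)` for every `l ≠ A`. -/
theorem multimodal_certification_modification {T : ℕ} {α : Fin T → Type*}
    [∀ i, DecidableEq (α i)] {L : Type*} [DecidableEq L]
    (m : ∀ i, Finset (α i)) (n r e k : Fin T → ℕ)
    (hn : ∀ i, (m i).card = n i) (hr : ∀ i, r i ≤ n i) (hk : ∀ i, k i ≤ n i - r i)
    (he : ∀ i, e i = n i - r i)
    (g : (∀ i, Finset (α i)) → L) (A : L) (pA pB : ℝ)
    (hpA0 : 0 ≤ pA) (hpA1 : pA ≤ 1) (hpB0 : 0 ≤ pB) (hpB1 : pB ≤ 1)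
    (hA : uniformProb (Fintype.piFinset fun i => (m i).powersetCard (k i))
        (fun z => g z = A) ≥ pA)
    (hB : ∀ l : L, l ≠ A →
      uniformProb (Fintype.piFinset fun i => (m i).powersetCard (k i))
        (fun z => g z = l) ≤ pB)
    (δl δu : ℝ)
    (hδl : δl = pA - (⌊pA * ∏ i, ((n i).choose (k i) : ℝ)⌋ : ℝ) / ∏ i, ((n i).choose (k i) : ℝ))
    (hδu : δu = (⌈pB * ∏ i, ((n i).choose (k i) : ℝ)⌉ : ℝ) / (∏ i, ((n i).choose (k i) : ℝ)) - pB)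
    (hcond : pA - δl - 1 + (∏ i, ((e i).choose (k i) : ℝ)) / (∏ i, ((n i).choose (k i) : ℝ))
      ≥ (pB + δu) + 1 - (∏ i, ((e i).choose (k i) : ℝ)) / (∏ i, ((n i).choose (k i) : ℝ))) :
    ∀ m' : ∀ i, Finset (α i),
      (∀ i, (m' i).card = n i) → (∀ i, (m i ∩ m' i).card ≥ n i - r i) →
      ∀ l : L, l ≠ A →
        uniformProb (Fintype.piFinset fun i => (m' i).powersetCard (k i)) (fun z => g z = A)
          ≥ uniformProb (Fintype.piFinset fun i => (m' i).powersetCard (k i)) (fun z => g z = l) := by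
  intro m' hm' hinter l hl
  have hE := prod_choose_le_card_inter_piFinset_powersetCard m m' e k
    fun i => (he i).trans_le (hinter i)
  have hX := card_piFinset_powersetCard m k
  have hY := card_piFinset_powersetCard m' k
  simp only [hn] at hX
  simp only [hm'] at hY
  have hN : 0 < ∏ i, (n i).choose (k i) :=
    Finset.prod_pos fun i _ => Nat.choose_pos ((hk i).trans (Nat.sub_le _ _))
  specialize hB l hl
  simp only [uniformProb, hX, hY, ← Nat.cast_prod] at hA hB hδl hδu hcond ⊢
  set ΩX := Fintype.piFinset fun i => (m i).powersetCard (k i)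
  set ΩY := Fintype.piFinset fun i => (m' i).powersetCard (k i)
  set N := ∏ i, (n i).choose (k i)
  set E := ∏ i, (e i).choose (k i)
  have hA' := card_filter_le_card_filter_add_card_sdiff ΩX ΩY (fun z => g z = A)
  have hl' := card_filter_le_card_filter_add_card_sdiff ΩY ΩX (fun z => g z = l)
  have hXY := Finset.card_sdiff_add_card_inter ΩX ΩY
  have hYX := Finset.card_sdiff_add_card_inter ΩY ΩX
  rw [Finset.inter_comm] at hYX
  have hNR : (0 : ℝ) < N := by exact_mod_cast hN
  have hfloor := Int.floor_le (pA * (N : ℝ))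
  have hceil := Int.le_ceil (pB * (N : ℝ))
  rw [ge_iff_le, le_div_iff₀ hNR] at hA
  rw [div_le_iff₀ hNR] at hB
  have hcond' : (⌈pB * (N : ℝ)⌉ : ℝ) + 2 * (N - E) ≤ ⌊pA * (N : ℝ)⌋ := by
    subst hδl hδu
    generalize ⌊pA * (N : ℝ)⌋ = a at hcond ⊢
    generalize ⌈pB * (N : ℝ)⌉ = b at hcond ⊢
    field_simp at hcond
    linarith
  have hcount : ((ΩX.filter fun z => g z = l).card : ℝ) + 2 * (N - E) ≤
      (ΩX.filter fun z => g z = A).card := by linarith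
  have hcount' : (ΩX.filter fun z => g z = l).card + 2 * N ≤
      (ΩX.filter fun z => g z = A).card + 2 * E := by
    have : ((ΩX.filter fun z => g z = l).card : ℝ) + 2 * N ≤
      (ΩX.filter fun z => g z = A).card + 2 * E := by linarith
    exact_mod_cast this
  have hfinal : (ΩY.filter fun z => g z = l).card ≤ (ΩY.filter fun z => g z = A).card := by
    omega
  gcongr
end
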